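/- For every state-feedback policy μ : X → U and all initial states x₀, x₀' ∈ X, the decentralized policy μ_d for the server-dependent cost problem satisfies J̄(μ_d, x₀) ≤ 2 · J_(μ, x₀'). In particular, the limsup average cost of μ_d is at most twice the liminf average cost of an optimal state-feedback policy from any initial state. -/

import Mathlib

open Filter Finset

/-- Distribution of the chain after `t` steps under kernel `K`, started at `x₀`:
the `t`-fold monadic bind of `K` applied to the point mass at `x₀`. -/
noncomputable def chainDist {X : Type*} (K : X → PMF X) (x₀ : X) : ℕ → PMF X
  | 0 => PMF.pure x₀
  | t + 1 => (chainDist K x₀ t).bind K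

/-- Expectation of `f` under a PMF on a finite type. -/
noncomputable def pmfExp {X : Type*} [Fintype X] (q : PMF X) (f : X → ℝ) : ℝ :=
  ∑ x, (q x).toReal * f x

/-- The average cost over periods `0,…,T` of running the Markov chain with step
kernel `K` and per-stage cost `c`, started at `x₀`. -/
noncomputable def avgCost {X : Type*} [Fintype X] (K : X → PMF X) (c : X → ℝ)
    (x₀ : X) (T : ℕ) : ℝ :=
  (1 / (T + 1 : ℝ)) * ∑ t ∈ Finset.range (T + 1), pmfExp (chainDist K x₀ t) c

/-- Step kernel of the stochastic `k`-server problem under policy `μ`: server `μ x`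
relocates to the request location `x.1` and the next request is drawn from `p`. -/
noncomputable def kServerKernel {S : Type*} {k : ℕ} (p : PMF S)
    (μ : S × (Fin k → S) → Fin k) (x : S × (Fin k → S)) : PMF (S × (Fin k → S)) :=
  p.map (fun s => (s, Function.update x.2 (μ x) x.1))

/-- Per-stage cost with server-dependent travel metrics `d` and processing costs `c`:
`r(x, u) = d_u(x_u, x̂) + c_u(x̂)` evaluated at `u = μ x`. -/
noncomputable def sdCost {S : Type*} {k : ℕ} (d : Fin k → S → S → ℝ)
    (c : Fin k → S → ℝ) (μ : S × (Fin k → S) → Fin k) (x : S × (Fin k → S)) : ℝ :=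
  d (μ x) (x.2 (μ x)) x.1 + c (μ x) x.1

/-- The generalized `k`-median objective
`g'(m) = Σ_s p(s) · min_i (d_i(m_i, s) + c_i(s))`. -/
noncomputable def sdMedian {S : Type*} [Fintype S] {k : ℕ} [NeZero k]
    (p : PMF S) (d : Fin k → S → S → ℝ) (c : Fin k → S → ℝ) (m : Fin k → S) : ℝ :=
  ∑ s, (p s).toReal *
    Finset.univ.inf' Finset.univ_nonempty (fun i => d i (m i) s + c i s)

section PmfExp

variable {X Y : Type*} [Fintype X] [Fintype Y]

lemma pmfExp_pure (x : X) (f : X → ℝ) : pmfExp (PMF.pure x) f = f x := by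
  classical
  simp [pmfExp, PMF.pure_apply, apply_ite ENNReal.toReal]

lemma pmfExp_bind (q : PMF X) (K : X → PMF Y) (f : Y → ℝ) :
    pmfExp (q.bind K) f = pmfExp q (fun x => pmfExp (K x) f) := by
  have h (y : Y) : (q.bind K y).toReal = ∑ x, (q x).toReal * (K x y).toReal := by
    rw [PMF.bind_apply, tsum_fintype, ENNReal.toReal_sum fun x _ =>
      ENNReal.mul_ne_top (q.apply_ne_top x) ((K x).apply_ne_top y)]
    simp [ENNReal.toReal_mul]
  simp only [pmfExp, h, Finset.sum_mul, Finset.mul_sum]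
  rw [Finset.sum_comm]
  simp [mul_assoc]

lemma pmfExp_map (q : PMF X) (g : X → Y) (f : Y → ℝ) :
    pmfExp (q.map g) f = pmfExp q (fun x => f (g x)) := by
  simp [← PMF.bind_pure_comp, pmfExp_bind, pmfExp_pure]

lemma pmfExp_const (q : PMF X) (a : ℝ) : pmfExp q (fun _ => a) = a := by
  have h : ∑ x, (q x).toReal = 1 := by
    rw [← ENNReal.toReal_sum fun x _ => q.apply_ne_top x, ← tsum_fintype (L := .unconditional X),
      q.tsum_coe, ENNReal.toReal_one]
  rw [pmfExp, ← Finset.sum_mul, h, one_mul]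

lemma pmfExp_mono (q : PMF X) {f g : X → ℝ} (h : ∀ x, f x ≤ g x) : pmfExp q f ≤ pmfExp q g :=
  Finset.sum_le_sum fun x _ => mul_le_mul_of_nonneg_left (h x) ENNReal.toReal_nonneg

lemma pmfExp_add (q : PMF X) (f g : X → ℝ) :
    pmfExp q (fun x => f x + g x) = pmfExp q f + pmfExp q g := by
  simp [pmfExp, mul_add, Finset.sum_add_distrib]

lemma pmfExp_const_mul (q : PMF X) (a : ℝ) (f : X → ℝ) :
    pmfExp q (fun x => a * f x) = a * pmfExp q f := by
  simp [pmfExp, Finset.mul_sum, mul_left_comm]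

lemma pmfExp_nonneg (q : PMF X) {f : X → ℝ} (h : ∀ x, 0 ≤ f x) : 0 ≤ pmfExp q f :=
  Finset.sum_nonneg fun x _ => mul_nonneg ENNReal.toReal_nonneg (h x)

end PmfExp

section Chain

variable {X : Type*} [Fintype X] (K : X → PMF X) (x₀ : X)

lemma pmfExp_chainDist_succ (f : X → ℝ) (t : ℕ) :
    pmfExp (chainDist K x₀ (t + 1)) f =
      pmfExp (chainDist K x₀ t) (fun x => pmfExp (K x) f) :=
  pmfExp_bind _ _ _

/-- Telescoping a drift inequality `r + K Φ ≤ Φ + h` along the chain. -/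
lemma sum_pmfExp_chainDist_le_of_drift {r Φ h : X → ℝ}
    (hdrift : ∀ x, r x + pmfExp (K x) Φ ≤ Φ x + h x) (n : ℕ) :
    ∑ t ∈ Finset.range n, pmfExp (chainDist K x₀ t) r + pmfExp (chainDist K x₀ n) Φ ≤
      Φ x₀ + ∑ t ∈ Finset.range n, pmfExp (chainDist K x₀ t) h := by
  induction n with
  | zero => simp [chainDist, pmfExp_pure]
  | succ n ih =>
    have := pmfExp_mono (chainDist K x₀ n) hdrift
    rw [pmfExp_add, pmfExp_add, ← pmfExp_chainDist_succ] at this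
    rw [Finset.sum_range_succ, Finset.sum_range_succ]
    linarith

lemma avgCost_nonneg {r : X → ℝ} (hr : ∀ x, 0 ≤ r x) (T : ℕ) : 0 ≤ avgCost K r x₀ T :=
  mul_nonneg (by positivity) (Finset.sum_nonneg fun _ _ => pmfExp_nonneg _ hr)

lemma avgCost_le_of_le {r : X → ℝ} {M : ℝ} (hr : ∀ x, r x ≤ M) (T : ℕ) :
    avgCost K r x₀ T ≤ M := by
  have h : ∑ t ∈ Finset.range (T + 1), pmfExp (chainDist K x₀ t) r ≤ (T + 1 : ℝ) * M := by
    refine (Finset.sum_le_card_nsmul _ _ M fun t _ => ?_).trans_eq (by simp)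
    exact (pmfExp_mono _ hr).trans_eq (pmfExp_const _ _)
  rw [avgCost, one_div_mul_eq_div, div_le_iff₀ (by positivity)]
  linarith

lemma tendsto_add_div_succ (a b : ℝ) :
    Tendsto (fun T : ℕ => a + b * (1 / ((T : ℝ) + 1))) atTop (nhds a) := by
  simpa using (tendsto_one_div_add_atTop_nhds_zero_nat.const_mul b).const_add a

/-- If the expected cost of the next stage is at least `G` from every state, the liminf average
cost is at least `G`. -/
lemma le_liminf_avgCost {r : X → ℝ} {G : ℝ} (hr : ∀ x, 0 ≤ r x)
    (hG : ∀ x, G ≤ pmfExp (K x) r) : G ≤ liminf (avgCost K r x₀) atTop := by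
  have hlim := tendsto_add_div_succ G (-G)
  rw [← hlim.liminf_eq]
  refine liminf_le_liminf (Eventually.of_forall fun T => ?_) hlim.isBoundedUnder_ge ?_
  · have h : (T : ℝ) * G ≤ ∑ t ∈ Finset.range (T + 1), pmfExp (chainDist K x₀ t) r := by
      rw [Finset.sum_range_succ']
      have h₁ : (T : ℝ) * G ≤ ∑ t ∈ Finset.range T, pmfExp (chainDist K x₀ (t + 1)) r := by
        refine le_of_eq_of_le (by simp) (Finset.card_nsmul_le_sum _ _ G fun t _ => ?_)
        rw [pmfExp_chainDist_succ]
        exact (pmfExp_const _ _).symm.trans_le (pmfExp_mono _ hG)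
      linarith [pmfExp_nonneg (chainDist K x₀ 0) hr]
    rw [avgCost, one_div_mul_eq_div, le_div_iff₀ (by positivity)]
    refine le_of_eq_of_le ?_ h
    field_simp
    ring
  · obtain ⟨M, hM⟩ := (Set.finite_range r).bddAbove
    exact (isBoundedUnder_of ⟨M, avgCost_le_of_le K x₀ fun x => hM ⟨x, rfl⟩⟩).isCoboundedUnder_ge

/-- If `r` satisfies a drift inequality with nonnegative potential `Φ` and a bound `h` whose
expectation at the next stage is `G` from every state, the limsup average cost is at most `G`. -/
lemma limsup_avgCost_le_of_drift {r Φ h : X → ℝ} {G : ℝ} (hr : ∀ x, 0 ≤ r x)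
    (hΦ : ∀ x, 0 ≤ Φ x) (hdrift : ∀ x, r x + pmfExp (K x) Φ ≤ Φ x + h x)
    (hG : ∀ x, pmfExp (K x) h = G) : limsup (avgCost K r x₀) atTop ≤ G := by
  have hlim := tendsto_add_div_succ G (Φ x₀ + h x₀ - G)
  rw [← hlim.limsup_eq]
  refine limsup_le_limsup (Eventually.of_forall fun T => ?_) ?_ hlim.isBoundedUnder_le
  · have h₁ := sum_pmfExp_chainDist_le_of_drift K x₀ hdrift (T + 1)
    have h₂ : ∑ t ∈ Finset.range (T + 1), pmfExp (chainDist K x₀ t) h = T * G + h x₀ := by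
      rw [Finset.sum_range_succ']
      simp only [pmfExp_chainDist_succ, hG, pmfExp_const]
      simp [chainDist, pmfExp_pure]
    have h₃ := pmfExp_nonneg (chainDist K x₀ (T + 1)) hΦ
    rw [avgCost, one_div_mul_eq_div, div_le_iff₀ (by positivity)]
    have h₄ : (G + (Φ x₀ + h x₀ - G) * (1 / ((T : ℝ) + 1))) * (T + 1) =
        Φ x₀ + (T * G + h x₀) := by
      field_simp
      ring
    linarith
  · exact (isBoundedUnder_of ⟨0, avgCost_nonneg K x₀ hr⟩).isCoboundedUnder_le

end Chain

/-- For the stochastic `k`-server problem with server-dependent processing costs, the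
decentralized policy has limsup average cost at most twice the liminf average cost of
any state-feedback policy. -/
theorem sd_decentralized_policy_within_factor_two
    {S : Type*} [Fintype S] [Nonempty S] {k : ℕ} [NeZero k]
    (p : PMF S) (d : Fin k → S → S → ℝ) (c : Fin k → S → ℝ)
    (hd_nonneg : ∀ i a b, 0 ≤ d i a b)
    (hd_self : ∀ i a, d i a a = 0)
    (hd_symm : ∀ i a b, d i a b = d i b a)
    (hd_tri : ∀ i a b e, d i a e ≤ d i a b + d i b e)
    (hc : ∀ i s, 0 ≤ c i s)
    (mstar : Fin k → S)
    (hmstar : ∀ m : Fin k → S, sdMedian p d c mstar ≤ sdMedian p d c m)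
    (μd : S × (Fin k → S) → Fin k)
    (hμd : ∀ x : S × (Fin k → S), ∀ j : Fin k,
      d (μd x) (mstar (μd x)) x.1 + c (μd x) x.1 ≤ d j (mstar j) x.1 + c j x.1)
    (μ : S × (Fin k → S) → Fin k) (x₀ x₀' : S × (Fin k → S)) :
    limsup (avgCost (kServerKernel p μd) (sdCost d c μd) x₀) atTop ≤
      2 * liminf (avgCost (kServerKernel p μ) (sdCost d c μ) x₀') atTop := by
  have hr (ν : S × (Fin k → S) → Fin k) (x) : 0 ≤ sdCost d c ν x :=
    add_nonneg (hd_nonneg _ _ _) (hc _ _)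
  have lower : sdMedian p d c mstar ≤
      liminf (avgCost (kServerKernel p μ) (sdCost d c μ) x₀') atTop := by
    refine le_liminf_avgCost _ _ (hr μ) fun x => ?_
    rw [kServerKernel, pmfExp_map]
    exact (hmstar (Function.update x.2 (μ x) x.1)).trans
      (pmfExp_mono p fun s => Finset.inf'_le _ (Finset.mem_univ _))
  have upper : limsup (avgCost (kServerKernel p μd) (sdCost d c μd) x₀) atTop ≤
      2 * sdMedian p d c mstar := by
    refine limsup_avgCost_le_of_drift _ _ (Φ := fun x => ∑ i, d i (x.2 i) (mstar i))
      (h := fun x => 2 * Finset.univ.inf' Finset.univ_nonempty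
        (fun i => d i (mstar i) x.1 + c i x.1)) (hr μd)
      (fun x => Finset.sum_nonneg fun i _ => hd_nonneg _ _ _) (fun x => ?_) (fun x => ?_)
    · rw [kServerKernel, pmfExp_map]
      simp only [pmfExp_const]
      have hmin : d (μd x) (mstar (μd x)) x.1 + c (μd x) x.1 ≤
          Finset.univ.inf' Finset.univ_nonempty (fun i => d i (mstar i) x.1 + c i x.1) :=
        Finset.le_inf' _ _ fun j _ => hμd x j
      have hrest : ∑ i ∈ Finset.univ.erase (μd x),
            d i (Function.update x.2 (μd x) x.1 i) (mstar i) =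
          ∑ i ∈ Finset.univ.erase (μd x), d i (x.2 i) (mstar i) :=
        Finset.sum_congr rfl fun i hi => by
          rw [Function.update_of_ne (Finset.ne_of_mem_erase hi)]
      rw [← Finset.add_sum_erase _ _ (Finset.mem_univ (μd x)),
        ← Finset.add_sum_erase _ (fun i => d i (x.2 i) (mstar i)) (Finset.mem_univ (μd x)),
        hrest, Function.update_self, sdCost, hd_symm _ x.1]
      linarith [hd_tri (μd x) (x.2 (μd x)) (mstar (μd x)) x.1, hc (μd x) x.1]
    · rw [kServerKernel, pmfExp_map, pmfExp_const_mul]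
      rfl
  linarith
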